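/- Frame-relative uncertainty relation for smeared system observables relative to a phase-space frame (Eq. (18) of the paper, bound 2): let ψ, φ, χ, θ be Schwartz functions on ℝ, each with unit L² norm. Let A = |θ|² ⋆ |χ|² ⋆ |φ|² ⋆ |ψ|² and B = |𝓕θ|² ⋆ |𝓕χ|² ⋆ |𝓕φ|² ⋆ |𝓕ψ|² (convolutions of functions with respect to Lebesgue measure). Then Δ(A)·Δ(B) ≥ 1/π. (A and B are, up to reflection, the distributions of the frame-conditioned smeared position and momentum of the system in state ψ with smearing generated by θ, relative to a covariant phase-space frame generated by χ and prepared in state φ.) -/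

import Mathlib

open MeasureTheory
open scoped FourierTransform

/-- Mean of the probability measure on ℝ with density `h` w.r.t. Lebesgue measure. -/
noncomputable def dMean (h : ℝ → ℝ) : ℝ := ∫ x, x * h x

/-- Variance Δ² of the probability measure on ℝ with density `h`. -/
noncomputable def dVar (h : ℝ → ℝ) : ℝ := ∫ x, (x - dMean h) ^ 2 * h x

/-- Standard deviation Δ of the probability measure on ℝ with density `h`. -/
noncomputable def dStd (h : ℝ → ℝ) : ℝ := Real.sqrt (dVar h)

/-- Convolution of real functions on ℝ w.r.t. Lebesgue measure. -/
noncomputable def fConv (f g : ℝ → ℝ) : ℝ → ℝ := fun q => ∫ y, f (q - y) * g y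

/-- `h` is integrable, has finite first and second moments, and integrates to one. -/
structure HasUnitMassAndMoments (h : ℝ → ℝ) : Prop where
  integrable : Integrable h
  integrable_id_mul : Integrable fun x => x * h x
  integrable_sq_mul : Integrable fun x => x ^ 2 * h x
  integral_eq_one : ∫ x, h x = 1

lemma HasUnitMassAndMoments.dVar_eq {h : ℝ → ℝ} (hh : HasUnitMassAndMoments h) :
    dVar h = (∫ x, x ^ 2 * h x) - dMean h ^ 2 := by
  have h₁ : ∀ x, (x - dMean h) ^ 2 * h x =
      x ^ 2 * h x - 2 * dMean h * (x * h x) + dMean h ^ 2 * h x := fun x => by ring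
  have i₁ := hh.integrable_id_mul.const_mul (2 * dMean h)
  have i₂ := hh.integrable.const_mul (dMean h ^ 2)
  rw [dVar, integral_congr_ae (Filter.Eventually.of_forall h₁),
    integral_add (hh.integrable_sq_mul.sub' i₁) i₂, integral_sub hh.integrable_sq_mul i₁,
    integral_const_mul, integral_const_mul, hh.integral_eq_one, ← dMean]
  ring

/-- Weighted integrals of a convolution, computed on the product space. -/
lemma integrable_and_integral_mul_fConv {f g p : ℝ → ℝ}
    (h : Integrable (fun z : ℝ × ℝ => p (z.1 + z.2) * (f z.1 * g z.2))) :
    Integrable (fun q => p q * fConv f g q) ∧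
      ∫ q, p q * fConv f g q = ∫ z : ℝ × ℝ, p (z.1 + z.2) * (f z.1 * g z.2) := by
  have hS : MeasurePreserving (fun z : ℝ × ℝ => (z.1 - z.2, z.2)) :=
    measurePreserving_sub_prod (volume : Measure ℝ) (volume : Measure ℝ)
  have hc : ((fun z : ℝ × ℝ => p (z.1 + z.2) * (f z.1 * g z.2)) ∘ fun z => (z.1 - z.2, z.2)) =
      fun z : ℝ × ℝ => p z.1 * (f (z.1 - z.2) * g z.2) := by
    ext z
    simp
  have hi := hS.integrable_comp_of_integrable h
  rw [hc] at hi
  have hq : ∀ q, ∫ y, p q * (f (q - y) * g y) = p q * fConv f g q :=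
    fun q => integral_const_mul _ _
  refine ⟨hi.integral_prod_left.congr (Filter.Eventually.of_forall hq), ?_⟩
  rw [← integral_congr_ae (Filter.Eventually.of_forall hq)]
  have h₁ := integral_map hS.aemeasurable (hS.map_eq.symm ▸ h.aestronglyMeasurable)
  rw [hS.map_eq] at h₁
  rw [h₁, ← integral_prod _ hi]
  exact integral_congr_ae (Filter.Eventually.of_forall fun z => (congrFun hc z).symm)

namespace HasUnitMassAndMoments

variable {f g : ℝ → ℝ}

lemma convolve_and_moments (hf : HasUnitMassAndMoments f) (hg : HasUnitMassAndMoments g) :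
    HasUnitMassAndMoments (fConv f g) ∧ dMean (fConv f g) = dMean f + dMean g ∧
      ∫ q, q ^ 2 * fConv f g q =
        (∫ x, x ^ 2 * f x) + 2 * (dMean f * dMean g) + ∫ x, x ^ 2 * g x := by
  have i₀ := hf.integrable.mul_prod hg.integrable
  have i₁ := hf.integrable_id_mul.mul_prod hg.integrable
  have i₂ := hf.integrable.mul_prod hg.integrable_id_mul
  have i₃ := hf.integrable_sq_mul.mul_prod hg.integrable
  have i₄ := (hf.integrable_id_mul.mul_prod hg.integrable_id_mul).const_mul 2
  have i₅ := hf.integrable.mul_prod hg.integrable_sq_mul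
  have e₀ : (fun z : ℝ × ℝ => (fun _ => (1 : ℝ)) (z.1 + z.2) * (f z.1 * g z.2)) =
      fun z => f z.1 * g z.2 := by ext; simp
  have e₁ : (fun z : ℝ × ℝ => (fun x => x) (z.1 + z.2) * (f z.1 * g z.2)) =
      fun z => z.1 * f z.1 * g z.2 + f z.1 * (z.2 * g z.2) := by ext; ring
  have e₂ : (fun z : ℝ × ℝ => (fun x => x ^ 2) (z.1 + z.2) * (f z.1 * g z.2)) =
      fun z => z.1 ^ 2 * f z.1 * g z.2 + 2 * (z.1 * f z.1 * (z.2 * g z.2)) +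
        f z.1 * (z.2 ^ 2 * g z.2) := by ext; ring
  obtain ⟨a₀, b₀⟩ := integrable_and_integral_mul_fConv (f := f) (g := g) (p := fun _ => 1)
    (e₀ ▸ i₀)
  obtain ⟨a₁, b₁⟩ := integrable_and_integral_mul_fConv (f := f) (g := g) (p := fun x => x)
    (e₁ ▸ i₁.fun_add i₂)
  obtain ⟨a₂, b₂⟩ := integrable_and_integral_mul_fConv (f := f) (g := g) (p := fun x => x ^ 2)
    (e₂ ▸ (i₃.fun_add i₄).fun_add i₅)
  have mf := hf.integral_eq_one
  have mg := hg.integral_eq_one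
  rw [e₀, Measure.volume_eq_prod, integral_prod_mul, mf, mg] at b₀
  rw [e₁, Measure.volume_eq_prod, integral_add i₁ i₂,
    integral_prod_mul (fun x => x * f x), integral_prod_mul f (fun x => x * g x), mf, mg] at b₁
  rw [e₂, Measure.volume_eq_prod, integral_add (i₃.fun_add i₄) i₅, integral_add i₃ i₄,
    integral_const_mul, integral_prod_mul (fun x => x ^ 2 * f x),
    integral_prod_mul (fun x => x * f x) (fun x => x * g x),
    integral_prod_mul f (fun x => x ^ 2 * g x), mf, mg] at b₂
  simp only [one_mul, mul_one] at a₀ b₀ b₁ b₂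
  exact ⟨⟨a₀, a₁, a₂, b₀⟩, b₁, b₂⟩

lemma convolve (hf : HasUnitMassAndMoments f) (hg : HasUnitMassAndMoments g) :
    HasUnitMassAndMoments (fConv f g) := (hf.convolve_and_moments hg).1

/-- The variance is additive under convolution. -/
lemma dVar_fConv (hf : HasUnitMassAndMoments f) (hg : HasUnitMassAndMoments g) :
    dVar (fConv f g) = dVar f + dVar g := by
  obtain ⟨h, h₁, h₂⟩ := hf.convolve_and_moments hg
  rw [h.dVar_eq, hf.dVar_eq, hg.dVar_eq, h₁, h₂]
  ring

end HasUnitMassAndMoments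

lemma SchwartzMap.integrable_pow_mul_norm_mul_norm (f g : SchwartzMap ℝ ℂ) (k : ℕ) :
    Integrable fun x : ℝ => |x| ^ k * (‖f x‖ * ‖g x‖) := by
  obtain ⟨C, hC⟩ : ∃ C, ∀ x, ‖g x‖ ≤ C :=
    ⟨_, fun x => g.toBoundedContinuousFunction.norm_coe_le_norm x⟩
  have := (f.integrable_pow_mul volume k).mul_bdd (c := C) (g := fun x => ‖g x‖)
    g.continuous.norm.aestronglyMeasurable (Filter.Eventually.of_forall fun x => by simpa using hC x)
  simpa [mul_assoc] using this

lemma SchwartzMap.hasUnitMassAndMoments_norm_sq (f : SchwartzMap ℝ ℂ)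
    (hf : ∫ x, ‖f x‖ ^ 2 = 1) : HasUnitMassAndMoments fun x => ‖f x‖ ^ 2 := by
  have h := f.integrable_pow_mul_norm_mul_norm f
  have hc := f.continuous
  refine ⟨by simpa [sq] using h 0, ?_, ?_, hf⟩
  · exact (h 1).mono (by fun_prop) (Filter.Eventually.of_forall fun x => by simp [sq])
  · exact (h 2).mono (by fun_prop) (Filter.Eventually.of_forall fun x => by simp [sq])

lemma dVar_nonneg {h : ℝ → ℝ} (hh : ∀ x, 0 ≤ h x) : 0 ≤ dVar h :=
  integral_nonneg fun x => mul_nonneg (sq_nonneg _) (hh x)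

/-- A Schwartz function whose Fourier transform is `2πi(ξ - b)` times that of `f`. -/
lemma SchwartzMap.exists_fourier_eq_sub_mul (f : SchwartzMap ℝ ℂ) (b : ℝ) :
    ∃ g : SchwartzMap ℝ ℂ, (∀ x, inner ℝ (f x) (g x) = inner ℝ (f x) (deriv f x)) ∧
      ∀ ξ, 𝓕 g ξ = 2 * Real.pi * Complex.I * (ξ - b) * 𝓕 (fun x => f x) ξ := by
  refine ⟨derivCLM ℂ ℂ f - (2 * Real.pi * Complex.I * b) • f, fun x => ?_, fun ξ => ?_⟩
  · simp [inner_sub_right, Complex.inner]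
    ring
  · have h₁ : 𝓕 (derivCLM ℂ ℂ f) ξ = 2 * Real.pi * Complex.I * ξ * 𝓕 (fun x => f x) ξ :=
      congrFun (Real.fourier_deriv f.integrable f.differentiable (derivCLM ℂ ℂ f).integrable) ξ
    rw [sub_eq_add_neg, ← neg_smul, FourierTransform.fourier_add, FourierTransform.fourier_smul,
      add_apply, smul_apply, h₁, fourier_coe]
    simp only [smul_eq_mul]
    ring

/-- Heisenberg's uncertainty relation for Schwartz functions, with variances. -/
lemma SchwartzMap.heisenberg (f : SchwartzMap ℝ ℂ) (hf : ∫ x, ‖f x‖ ^ 2 = 1) :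
    (1 / (4 * Real.pi)) ^ 2 ≤
      dVar (fun x => ‖f x‖ ^ 2) * dVar (fun ξ => ‖𝓕 (fun x => f x) ξ‖ ^ 2) := by
  set a := dMean fun x => ‖f x‖ ^ 2
  set b := dMean fun ξ => ‖𝓕 (fun x => f x) ξ‖ ^ 2 with hb
  obtain ⟨g, hg, hFg⟩ := f.exists_fourier_eq_sub_mul b
  have hgnorm : ∫ x, ‖g x‖ ^ 2 =
      4 * Real.pi ^ 2 * dVar (fun ξ => ‖𝓕 (fun x => f x) ξ‖ ^ 2) := by
    rw [← integral_norm_sq_fourier, dVar, ← integral_const_mul]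
    refine integral_congr_ae (Filter.Eventually.of_forall fun ξ => ?_)
    simp only [hFg, norm_mul, ← Complex.ofReal_sub, Complex.norm_real, Complex.norm_I, mul_pow,
      Real.norm_eq_abs, sq_abs, Complex.norm_ofNat, one_pow, ← hb]
    ring
  have hfc := f.continuous
  have hgc := g.continuous
  have if₀ : Integrable fun x => ‖f x‖ ^ 2 := (f.hasUnitMassAndMoments_norm_sq hf).integrable
  have if₁ : Integrable fun x => (x - a) * ‖f x‖ ^ 2 := by
    simpa only [sub_mul] using
      (f.hasUnitMassAndMoments_norm_sq hf).integrable_id_mul.sub' (if₀.const_mul a)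
  have if₂ : Integrable fun x => (x - a) ^ 2 * ‖f x‖ ^ 2 := by
    have := ((f.hasUnitMassAndMoments_norm_sq hf).integrable_sq_mul.sub
      ((f.hasUnitMassAndMoments_norm_sq hf).integrable_id_mul.const_mul (2 * a))).add
      (if₀.const_mul (a ^ 2))
    refine this.congr (Filter.Eventually.of_forall fun x => ?_)
    simp only [Pi.add_apply, Pi.sub_apply]
    ring
  have ig : Integrable fun x => ‖g x‖ ^ 2 := by
    simpa [sq] using g.integrable_pow_mul_norm_mul_norm g 0
  have ifg : Integrable fun x => (x - a) * inner ℝ (f x) (g x) := by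
    refine (if₂.add ig).mono (by fun_prop) (Filter.Eventually.of_forall fun x => ?_)
    have h₁ := abs_real_inner_le_norm (f x) (g x)
    have h₂ : 0 ≤ (x - a) ^ 2 * ‖f x‖ ^ 2 + ‖g x‖ ^ 2 := by positivity
    have h₃ := mul_le_mul_of_nonneg_left h₁ (abs_nonneg (x - a))
    simp only [Pi.add_apply, Real.norm_eq_abs, abs_mul, abs_of_nonneg h₂]
    rw [← sq_abs (x - a)]
    nlinarith [sq_nonneg (|x - a| * ‖f x‖ - ‖g x‖), sq_nonneg (|x - a| * ‖f x‖ + ‖g x‖)]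
  have hparts : ∫ x, (x - a) * inner ℝ (f x) (g x) = -(1 / 2) := by
    have := integral_mul_deriv_eq_deriv_mul_of_integrable (u := fun x => x - a) (u' := fun _ => 1)
      (v := fun x => ‖f x‖ ^ 2) (v' := fun x => 2 * inner ℝ (f x) (g x))
      (fun x _ => (hasDerivAt_id x).sub_const a)
      (fun x _ => hg x ▸ (f.differentiableAt.hasDerivAt).norm_sq)
      ((ifg.const_mul 2).congr (Filter.Eventually.of_forall fun x => by simp; ring))
      (by simpa [Pi.mul_def] using if₀) if₁
    simp only [one_mul, hf, mul_left_comm _ (2 : ℝ), integral_const_mul] at this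
    linarith
  have hquad : ∀ t : ℝ, 0 ≤ dVar (fun x => ‖f x‖ ^ 2) * (t * t) + (-1) * t + ∫ x, ‖g x‖ ^ 2 := by
    intro t
    have h₁ : ∫ x, ((t * t) * ((x - a) ^ 2 * ‖f x‖ ^ 2) + (2 * t) * ((x - a) * inner ℝ (f x) (g x))
        + ‖g x‖ ^ 2) = dVar (fun x => ‖f x‖ ^ 2) * (t * t) + (-1) * t + ∫ x, ‖g x‖ ^ 2 := by
      rw [integral_add ((if₂.const_mul _).fun_add (ifg.const_mul _)) ig,
        integral_add (if₂.const_mul _) (ifg.const_mul _), integral_const_mul, integral_const_mul,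
        hparts, dVar]
      ring
    rw [← h₁]
    refine integral_nonneg fun x => ?_
    have h₂ := norm_add_sq_real ((t * (x - a)) • f x) (g x)
    rw [norm_smul, real_inner_smul_left, mul_pow, Real.norm_eq_abs, sq_abs] at h₂
    have := sq_nonneg ‖(t * (x - a)) • f x + g x‖
    simp only [Pi.zero_apply]
    linarith
  have hd := discrim_le_zero hquad
  rw [discrim, hgnorm] at hd
  have hpi := Real.pi_pos
  rw [div_pow, div_le_iff₀ (by positivity)]
  linarith

/-- Variance lower bounds for two conjugate pairs add up on the level of standard deviations. -/
lemma add_sq_le_add_mul_add {a b a' b' m n : ℝ} (ha : 0 ≤ a) (hb : 0 ≤ b) (ha' : 0 ≤ a')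
    (hb' : 0 ≤ b') (h : m ^ 2 ≤ a * b) (h' : n ^ 2 ≤ a' * b') :
    (m + n) ^ 2 ≤ (a + a') * (b + b') := by
  have h₁ : 2 * (m * n) ≤ a * b' + a' * b := by
    refine le_of_sq_le_sq ?_ (by positivity)
    have := mul_le_mul h h' (sq_nonneg n) (by positivity)
    nlinarith [sq_nonneg (a * b' - a' * b)]
  nlinarith

/-- Frame-relative uncertainty relation for smeared system observables relative to a
phase-space frame (Eq. (18), bound 2): with A = |θ|² ⋆ |χ|² ⋆ |φ|² ⋆ |ψ|² and
B = |𝓕θ|² ⋆ |𝓕χ|² ⋆ |𝓕φ|² ⋆ |𝓕ψ|², one has Δ(A)·Δ(B) ≥ 1/π. -/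
theorem stmt14 (ψ φ χ θ : SchwartzMap ℝ ℂ)
    (hψ : ∫ x, ‖ψ x‖ ^ 2 = 1) (hφ : ∫ x, ‖φ x‖ ^ 2 = 1)
    (hχ : ∫ x, ‖χ x‖ ^ 2 = 1) (hθ : ∫ x, ‖θ x‖ ^ 2 = 1) :
    dStd (fConv (fun y => ‖θ y‖ ^ 2) (fConv (fun y => ‖χ y‖ ^ 2)
        (fConv (fun y => ‖φ y‖ ^ 2) (fun y => ‖ψ y‖ ^ 2)))) *
      dStd (fConv (fun η => ‖𝓕 (fun x => θ x) η‖ ^ 2) (fConv (fun η => ‖𝓕 (fun x => χ x) η‖ ^ 2)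
        (fConv (fun η => ‖𝓕 (fun x => φ x) η‖ ^ 2) (fun η => ‖𝓕 (fun x => ψ x) η‖ ^ 2)))) ≥
      1 / Real.pi := by
  have hF : ∀ f : SchwartzMap ℝ ℂ, ∫ x, ‖f x‖ ^ 2 = 1 →
      HasUnitMassAndMoments fun ξ => ‖𝓕 (fun x => f x) ξ‖ ^ 2 := fun f hf =>
    (𝓕 f).hasUnitMassAndMoments_norm_sq (f.integral_norm_sq_fourier.trans hf)
  have mψ := ψ.hasUnitMassAndMoments_norm_sq hψ
  have mφ := φ.hasUnitMassAndMoments_norm_sq hφ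
  have mχ := χ.hasUnitMassAndMoments_norm_sq hχ
  have mθ := θ.hasUnitMassAndMoments_norm_sq hθ
  rw [dStd, dStd, mθ.dVar_fConv (mχ.convolve (mφ.convolve mψ)), mχ.dVar_fConv (mφ.convolve mψ),
    mφ.dVar_fConv mψ,
    (hF θ hθ).dVar_fConv ((hF χ hχ).convolve ((hF φ hφ).convolve (hF ψ hψ))),
    (hF χ hχ).dVar_fConv ((hF φ hφ).convolve (hF ψ hψ)), (hF φ hφ).dVar_fConv (hF ψ hψ)]
  have nn : ∀ f : ℝ → ℂ, 0 ≤ dVar fun x => ‖f x‖ ^ 2 := fun f => dVar_nonneg fun x => sq_nonneg _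
  have h₂ := add_sq_le_add_mul_add (nn _) (nn _) (nn _) (nn _) 
    (φ.heisenberg hφ) (ψ.heisenberg hψ)
  have h₃ := add_sq_le_add_mul_add (nn _) (nn _) (add_nonneg (nn _) (nn _))
    (add_nonneg (nn _) (nn _)) (χ.heisenberg hχ) h₂
  have h₄ := add_sq_le_add_mul_add (nn _) (nn _)
    (add_nonneg (nn _) (add_nonneg (nn _) (nn _)))
    (add_nonneg (nn _) (add_nonneg (nn _) (nn _)))
    (θ.heisenberg hθ) h₃
  have hs : 1 / (4 * Real.pi) + (1 / (4 * Real.pi) + (1 / (4 * Real.pi) + 1 / (4 * Real.pi))) =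
      1 / Real.pi := by
    field_simp
    norm_num
  rw [hs] at h₄
  rw [← Real.sqrt_mul (add_nonneg (nn _) (add_nonneg (nn _) (add_nonneg (nn _) (nn _))))]
  exact Real.le_sqrt_of_sq_le h₄
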